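/- The set of 4×4 complex matrices M that commute with I₂⊗σ₃ − σ₃⊗I₂ is exactly the ℂ-linear span of the six matrices I₂⊗I₂, I₂⊗σ₃, σ₃⊗I₂, σ₃⊗σ₃, σ₁⊗σ₁ − σ₂⊗σ₂, and σ₁⊗σ₂ + σ₂⊗σ₁. -/

import Mathlib

open Matrix
open scoped Kronecker ComplexOrder

/-- The first Pauli matrix. -/
noncomputable def σ1 : Matrix (Fin 2) (Fin 2) ℂ := !![0, 1; 1, 0]

/-- The second Pauli matrix. -/
noncomputable def σ2 : Matrix (Fin 2) (Fin 2) ℂ := !![0, -Complex.I; Complex.I, 0]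

/-- The third Pauli matrix. -/
noncomputable def σ3 : Matrix (Fin 2) (Fin 2) ℂ := !![1, 0; 0, -1]

/-- The 2×2 identity matrix. -/
noncomputable def I2 : Matrix (Fin 2) (Fin 2) ℂ := 1

/-- A matrix commutes with a diagonal matrix iff each of its entries is annihilated by the
difference of the corresponding diagonal entries. -/
theorem mul_diagonal_eq_diagonal_mul_iff {n R : Type*} [Fintype n] [DecidableEq n] [CommRing R]
    (M : Matrix n n R) (v : n → R) :
    M * diagonal v = diagonal v * M ↔ ∀ i j, (v j - v i) * M i j = 0 := by
  simp only [← Matrix.ext_iff, mul_diagonal, diagonal_mul, sub_mul, sub_eq_zero, mul_comm (M _ _)]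

theorem kronecker_σ3_sub_eq_diagonal :
    I2 ⊗ₖ σ3 - σ3 ⊗ₖ I2 = diagonal (fun i : Fin 2 × Fin 2 ↦ σ3 i.2 i.2 - σ3 i.1 i.1) := by
  ext ⟨i, j⟩ ⟨k, l⟩
  fin_cases i <;> fin_cases j <;> fin_cases k <;> fin_cases l <;> simp [I2, σ3]

/-- A matrix commutes with `I2 ⊗ₖ σ3 - σ3 ⊗ₖ I2` iff its off-diagonal entries vanish, except
possibly those connecting `(0, 0)` and `(1, 1)`. -/
theorem mul_kronecker_σ3_sub_comm_iff (M : Matrix (Fin 2 × Fin 2) (Fin 2 × Fin 2) ℂ) :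
    M * (I2 ⊗ₖ σ3 - σ3 ⊗ₖ I2) = (I2 ⊗ₖ σ3 - σ3 ⊗ₖ I2) * M ↔
      (M (0, 0) (0, 1) = 0 ∧ M (0, 0) (1, 0) = 0) ∧
      (M (0, 1) (0, 0) = 0 ∧ M (0, 1) (1, 0) = 0 ∧ M (0, 1) (1, 1) = 0) ∧
      (M (1, 0) (0, 0) = 0 ∧ M (1, 0) (0, 1) = 0 ∧ M (1, 0) (1, 1) = 0) ∧
      M (1, 1) (0, 1) = 0 ∧ M (1, 1) (1, 0) = 0 := by
  rw [kronecker_σ3_sub_eq_diagonal, mul_diagonal_eq_diagonal_mul_iff]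
  norm_num [Prod.forall, Fin.forall_fin_two, σ3, and_assoc]

theorem commutant_of_Vminus :
    {M : Matrix (Fin 2 × Fin 2) (Fin 2 × Fin 2) ℂ |
      M * (I2 ⊗ₖ σ3 - σ3 ⊗ₖ I2) = (I2 ⊗ₖ σ3 - σ3 ⊗ₖ I2) * M} =
    ↑(Submodule.span ℂ
      ({I2 ⊗ₖ I2, I2 ⊗ₖ σ3, σ3 ⊗ₖ I2, σ3 ⊗ₖ σ3,
        σ1 ⊗ₖ σ1 - σ2 ⊗ₖ σ2,
        σ1 ⊗ₖ σ2 + σ2 ⊗ₖ σ1} : Set (Matrix (Fin 2 × Fin 2) (Fin 2 × Fin 2) ℂ))) := by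
  ext M
  simp only [Set.mem_ofPred_eq, SetLike.mem_coe]
  constructor
  · intro h
    rw [mul_kronecker_σ3_sub_comm_iff] at h
    have decomposition : M =
        ((M (0, 0) (0, 0) + M (0, 1) (0, 1) + M (1, 0) (1, 0) + M (1, 1) (1, 1)) / 4) •
            (I2 ⊗ₖ I2) +
        ((M (0, 0) (0, 0) - M (0, 1) (0, 1) + M (1, 0) (1, 0) - M (1, 1) (1, 1)) / 4) •
            (I2 ⊗ₖ σ3) +
        ((M (0, 0) (0, 0) + M (0, 1) (0, 1) - M (1, 0) (1, 0) - M (1, 1) (1, 1)) / 4) •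
            (σ3 ⊗ₖ I2) +
        ((M (0, 0) (0, 0) - M (0, 1) (0, 1) - M (1, 0) (1, 0) + M (1, 1) (1, 1)) / 4) •
            (σ3 ⊗ₖ σ3) +
        ((M (0, 0) (1, 1) + M (1, 1) (0, 0)) / 4) • (σ1 ⊗ₖ σ1 - σ2 ⊗ₖ σ2) +
        ((M (0, 0) (1, 1) - M (1, 1) (0, 0)) * Complex.I / 4) •
            (σ1 ⊗ₖ σ2 + σ2 ⊗ₖ σ1) := by
      ext ⟨i, j⟩ ⟨k, l⟩
      fin_cases i <;> fin_cases j <;> fin_cases k <;> fin_cases l <;>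
        simp [I2, σ1, σ2, σ3] <;> grind [Complex.I_mul_I]
    rw [decomposition]
    refine add_mem (add_mem (add_mem (add_mem (add_mem ?_ ?_) ?_) ?_) ?_) ?_ <;>
      exact Submodule.smul_mem _ _ (Submodule.subset_span (by simp))
  · intro h
    induction h using Submodule.span_induction with
    | mem x hx =>
      simp only [Set.mem_insert_iff, Set.mem_singleton_iff] at hx
      rcases hx with rfl | rfl | rfl | rfl | rfl | rfl <;>
        rw [mul_kronecker_σ3_sub_comm_iff] <;> simp [I2, σ1, σ2, σ3]
    | zero => simp
    | add x y _ _ hx hy => rw [add_mul, mul_add, hx, hy]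
    | smul a x _ hx => rw [smul_mul_assoc, mul_smul_comm, hx]
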